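/- Fix θ, σ > 0, x ∈ (0,π), and 0 < c < d. Let u : [c,d] → (Ω → ℝ) be a centered Gaussian process with covariance E[u(s)u(t)] = (σ²/(θπ)) Σ_{k=1}^∞ k^{−2} sin²(kx) ( e^{−θk²|t−s|} − e^{−θk²(t+s)} ). For n ∈ ℕ set t_i := c + (d−c)i/n, i = 0, …, n. Then the estimator θ̂_{n,x} := 3(d−c)σ⁴ / ( π Σ_{i=1}^n ( u(t_i) − u(t_{i−1}) )⁴ ) converges in probability to θ as n → ∞. -/

import Mathlib

open MeasureTheory ProbabilityTheory Real Filter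

noncomputable section

/-- `u` is a centered Gaussian process on `S` with covariance function `C`:
every finite linear combination of its values at points of `S` is a centered real
Gaussian with the corresponding variance. -/
def IsCenteredGaussianField {Ω : Type*} [MeasurableSpace Ω] (P : Measure Ω)
    (u : ℝ → Ω → ℝ) (S : Set ℝ) (C : ℝ → ℝ → ℝ) : Prop :=
  ∀ (n : ℕ) (x : Fin n → ℝ), (∀ i, x i ∈ S) → ∀ a : Fin n → ℝ,
    Measure.map (fun ω => ∑ i, a i * u (x i) ω) P
      = gaussianReal 0 (∑ i, ∑ j, a i * a j * C (x i) (x j)).toNNReal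

/-- Temporal covariance, at a fixed spatial point `x`, of the solution of the stochastic
heat equation `du − θΔu dt = σ dW` on `[0, π]` with zero initial and Dirichlet boundary
conditions:
`E[u(s)u(t)] = (σ²/(θπ)) Σ_{k≥1} k^{−2} sin²(kx)(e^{−θk²|t−s|} − e^{−θk²(t+s)})`. -/
def heatCovTime (θ σ x s t : ℝ) : ℝ :=
  (σ ^ 2 / (θ * π)) * ∑' k : ℕ,
    Real.sin (((k : ℝ) + 1) * x) ^ 2 / ((k : ℝ) + 1) ^ 2 *
      (Real.exp (-(θ * ((k : ℝ) + 1) ^ 2 * |t - s|)) -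
        Real.exp (-(θ * ((k : ℝ) + 1) ^ 2 * (t + s))))

lemma integral_pow_two_mul_gaussianReal_one (k : ℕ) :
    ∫ y : ℝ, y ^ (2 * k) ∂gaussianReal 0 1 = (2 * k - 1 : ℕ).doubleFactorial := by
  rw [integral_gaussianReal_eq_integral_smul one_ne_zero]
  have key : ∫ y : ℝ in Set.Ioi 0, y ^ (2 * k) * rexp (-(1 / 2) * y ^ 2)
      = (1 / 2 : ℝ) ^ (-((2 * k : ℝ) + 1) / 2) * (1 / 2) * Real.Gamma (((2 * k : ℝ) + 1) / 2) := by
    rw [← _root_.integral_rpow_mul_exp_neg_mul_rpow two_pos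
      (by linarith [(Nat.cast_nonneg k : (0 : ℝ) ≤ k)]) (by norm_num)]
    refine setIntegral_congr_fun measurableSet_Ioi fun y _ => ?_
    norm_cast
  have habs : ∀ y : ℝ, gaussianPDFReal 0 1 y • y ^ (2 * k)
      = (√(2 * π))⁻¹ * (|y| ^ (2 * k) * rexp (-(1 / 2) * |y| ^ 2)) := by
    intro y
    rw [gaussianPDFReal, pow_mul |y|, sq_abs, ← pow_mul]
    simp only [NNReal.coe_one, mul_one, sub_zero, smul_eq_mul]
    rw [show -y ^ 2 / 2 = -(1 / 2) * y ^ 2 by ring]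
    ring
  simp_rw [habs]
  rw [integral_const_mul,
    integral_comp_abs (f := fun y => y ^ (2 * k) * rexp (-(1 / 2) * y ^ 2)), key,
    show ((2 * k : ℝ) + 1) / 2 = k + 1 / 2 by ring, Real.Gamma_nat_add_half,
    show -((2 * k : ℝ) + 1) / 2 = -((k : ℝ) + 1 / 2) by ring, one_div, Real.inv_rpow (by norm_num),
    Real.rpow_neg (by norm_num), inv_inv, Real.rpow_add (by norm_num), Real.rpow_natCast,
    ← one_div, ← one_div, ← Real.sqrt_eq_rpow, Real.sqrt_mul (by norm_num)]
  have := Real.sqrt_pos.2 Real.pi_pos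
  have : (0 : ℝ) < √2 := by positivity
  field_simp

lemma integral_pow_two_mul_gaussianReal (k : ℕ) (v : NNReal) :
    ∫ y, y ^ (2 * k) ∂gaussianReal 0 v = (v : ℝ) ^ k * (2 * k - 1 : ℕ).doubleFactorial := by
  have h := gaussianReal_map_const_mul (μ := 0) (v := 1) (√v)
  have hv : NNReal.mk (√v ^ 2) (sq_nonneg _) * 1 = v := by
    ext; simp
  rw [mul_zero, hv] at h
  rw [← h, integral_map (by fun_prop) (by fun_prop)]
  simp_rw [mul_pow, integral_const_mul, integral_pow_two_mul_gaussianReal_one, pow_mul √v]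
  rw [Real.sq_sqrt v.coe_nonneg]

section GaussianMoments

variable {Ω : Type*} [MeasurableSpace Ω] {P : Measure Ω} {X Y : Ω → ℝ} {v : NNReal}

lemma aemeasurable_of_map_eq_gaussianReal (h : P.map X = gaussianReal 0 v) :
    AEMeasurable X P := by
  by_contra hX
  have h0 := congrArg (fun μ => μ Set.univ) h
  simp [Measure.map_of_not_aemeasurable hX] at h0

lemma memLp_of_map_eq_gaussianReal (h : P.map X = gaussianReal 0 v) {p : ENNReal} (hp : p ≠ ⊤) :
    MemLp X p P := by
  have hm := memLp_id_gaussianReal' (μ := 0) (v := v) p hp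
  rw [← h, memLp_map_measure_iff aestronglyMeasurable_id
    (aemeasurable_of_map_eq_gaussianReal h)] at hm
  exact hm

lemma integral_pow_two_mul_of_map_eq_gaussianReal (h : P.map X = gaussianReal 0 v) (k : ℕ) :
    ∫ ω, X ω ^ (2 * k) ∂P = (v : ℝ) ^ k * (2 * k - 1 : ℕ).doubleFactorial := by
  rw [← integral_pow_two_mul_gaussianReal, ← h,
    integral_map (aemeasurable_of_map_eq_gaussianReal h) (by fun_prop)]

lemma integral_sq_of_map_eq_gaussianReal (h : P.map X = gaussianReal 0 v) :
    ∫ ω, X ω ^ 2 ∂P = v := by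
  simpa using integral_pow_two_mul_of_map_eq_gaussianReal h 1

lemma integral_pow_four_of_map_eq_gaussianReal (h : P.map X = gaussianReal 0 v) :
    ∫ ω, X ω ^ 4 ∂P = 3 * (∫ ω, X ω ^ 2 ∂P) ^ 2 := by
  have h4 := integral_pow_two_mul_of_map_eq_gaussianReal h 2
  rw [integral_sq_of_map_eq_gaussianReal h]
  norm_num [Nat.doubleFactorial] at h4
  rw [h4]; ring

lemma integral_pow_eight_of_map_eq_gaussianReal (h : P.map X = gaussianReal 0 v) :
    ∫ ω, X ω ^ 8 ∂P = 105 * (∫ ω, X ω ^ 2 ∂P) ^ 4 := by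
  have h8 := integral_pow_two_mul_of_map_eq_gaussianReal h 4
  rw [integral_sq_of_map_eq_gaussianReal h]
  norm_num [Nat.doubleFactorial] at h8
  rw [h8]; ring

/-- Every linear combination of `X` and `Y` is a centered real Gaussian variable. -/
def IsCenteredGaussianPair (P : Measure Ω) (X Y : Ω → ℝ) : Prop :=
  ∀ a b : ℝ, ∃ v : NNReal, P.map (fun ω => a * X ω + b * Y ω) = gaussianReal 0 v

namespace IsCenteredGaussianPair

lemma left (h : IsCenteredGaussianPair P X Y) : ∃ v : NNReal, P.map X = gaussianReal 0 v := by
  simpa using h 1 0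

lemma right (h : IsCenteredGaussianPair P X Y) : ∃ v : NNReal, P.map Y = gaussianReal 0 v := by
  simpa using h 0 1

lemma memLp_left (h : IsCenteredGaussianPair P X Y) {p : ENNReal} (hp : p ≠ ⊤) : MemLp X p P :=
  memLp_of_map_eq_gaussianReal h.left.choose_spec hp

lemma memLp_right (h : IsCenteredGaussianPair P X Y) {p : ENNReal} (hp : p ≠ ⊤) : MemLp Y p P :=
  memLp_of_map_eq_gaussianReal h.right.choose_spec hp

lemma integral_sq (h : IsCenteredGaussianPair P X Y) (a b : ℝ) :
    ∫ ω, (a * X ω + b * Y ω) ^ 2 ∂P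
      = a ^ 2 * ∫ ω, X ω ^ 2 ∂P + 2 * a * b * ∫ ω, X ω * Y ω ∂P + b ^ 2 * ∫ ω, Y ω ^ 2 ∂P := by
  have hX := (h.memLp_left (p := 2) (by simp)).integrable_sq
  have hY := (h.memLp_right (p := 2) (by simp)).integrable_sq
  have hXY : Integrable (fun ω => X ω * Y ω) P :=
    (h.memLp_left (p := 2) (by simp)).integrable_mul (h.memLp_right (p := 2) (by simp))
  have e : (fun ω => (a * X ω + b * Y ω) ^ 2)
      = fun ω => a ^ 2 * X ω ^ 2 + 2 * a * b * (X ω * Y ω) + b ^ 2 * Y ω ^ 2 := by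
    ext ω; ring
  have hS : Integrable (fun ω => a ^ 2 * X ω ^ 2 + 2 * a * b * (X ω * Y ω)) P :=
    (hX.const_mul _).add (hXY.const_mul _)
  rw [e, integral_add hS (hY.const_mul _),
    integral_add (hX.const_mul _) (hXY.const_mul _)]
  simp_rw [integral_const_mul]

lemma integral_pow_eight (h : IsCenteredGaussianPair P X Y) (a b : ℝ) :
    ∫ ω, (a * X ω + b * Y ω) ^ 8 ∂P = 105 * (a ^ 2 * ∫ ω, X ω ^ 2 ∂P
      + 2 * a * b * ∫ ω, X ω * Y ω ∂P + b ^ 2 * ∫ ω, Y ω ^ 2 ∂P) ^ 4 := by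
  obtain ⟨v, hv⟩ := h a b
  rw [integral_pow_eight_of_map_eq_gaussianReal hv, h.integral_sq]

lemma integrable_pow_eight (h : IsCenteredGaussianPair P X Y) (a b : ℝ) :
    Integrable (fun ω => (a * X ω + b * Y ω) ^ 8) P := by
  obtain ⟨v, hv⟩ := h a b
  have := (memLp_of_map_eq_gaussianReal hv (p := (8 : ℕ)) (by simp)).integrable_norm_pow (by simp)
  refine this.congr (ae_of_all _ fun ω => ?_)
  simp [Even.pow_abs (show Even 8 by decide)]

/-- Polarization of `x⁴ y⁴` into eighth powers of linear forms. -/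
lemma pow_four_mul_pow_four_eq (x y : ℝ) :
    x ^ 4 * y ^ 4 = ∑ i, (![68, 68, 378, 378, -1, -1, -1, -1] i / 5040)
      * (![1, 1, 1, 0, 1, 1, 2, 2] i * x + ![1, -1, 0, 1, 2, -2, 1, -1] i * y) ^ 8 := by
  simp [Fin.sum_univ_succ]
  ring

lemma integrable_pow_four_mul_pow_four (h : IsCenteredGaussianPair P X Y) :
    Integrable (fun ω => X ω ^ 4 * Y ω ^ 4) P := by
  simp_rw [pow_four_mul_pow_four_eq]
  exact integrable_finsetSum _ fun i _ => (h.integrable_pow_eight _ _).const_mul _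

lemma integral_pow_four_mul_pow_four (h : IsCenteredGaussianPair P X Y) :
    ∫ ω, X ω ^ 4 * Y ω ^ 4 ∂P
      = 9 * (∫ ω, X ω ^ 2 ∂P) ^ 2 * (∫ ω, Y ω ^ 2 ∂P) ^ 2
        + 72 * (∫ ω, X ω ^ 2 ∂P) * (∫ ω, Y ω ^ 2 ∂P) * (∫ ω, X ω * Y ω ∂P) ^ 2
        + 24 * (∫ ω, X ω * Y ω ∂P) ^ 4 := by
  simp_rw [pow_four_mul_pow_four_eq]
  rw [integral_finsetSum _ fun i _ => (h.integrable_pow_eight _ _).const_mul _]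
  simp_rw [integral_const_mul, h.integral_pow_eight]
  simp [Fin.sum_univ_succ]
  ring

lemma two_mul_abs_integral_mul_le (h : IsCenteredGaussianPair P X Y) :
    2 * |∫ ω, X ω * Y ω ∂P| ≤ ∫ ω, X ω ^ 2 ∂P + ∫ ω, Y ω ^ 2 ∂P := by
  have h1 := h.integral_sq 1 1
  have h2 := h.integral_sq 1 (-1)
  have n1 : 0 ≤ ∫ ω, (1 * X ω + 1 * Y ω) ^ 2 ∂P := integral_nonneg fun ω => sq_nonneg _
  have n2 : 0 ≤ ∫ ω, (1 * X ω + -1 * Y ω) ^ 2 ∂P := integral_nonneg fun ω => sq_nonneg _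
  rcases abs_cases (∫ ω, X ω * Y ω ∂P) with ⟨e, -⟩ | ⟨e, -⟩ <;> rw [e] <;> linarith

end IsCenteredGaussianPair

end GaussianMoments

section TrigSums

lemma abs_sum_antitone_mul_sub_le {g S : ℕ → ℝ} (hg : Antitone g) (hg0 : ∀ k, 0 ≤ g k)
    (hS : ∀ k, |S k| ≤ 1) (N : ℕ) :
    |∑ k ∈ Finset.range N, g k * (S (k + 1) - S k)| ≤ 2 * g 0 := by
  have key : ∀ N, |∑ k ∈ Finset.range N, g k * (S (k + 1) - S k) - g N * S N + g 0 * S 0|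
      ≤ g 0 - g N := by
    intro N
    induction N with
    | zero => simp
    | succ N ih =>
      rw [Finset.sum_range_succ]
      have e : ∑ k ∈ Finset.range N, g k * (S (k + 1) - S k) + g N * (S (N + 1) - S N)
          - g (N + 1) * S (N + 1) + g 0 * S 0
          = (∑ k ∈ Finset.range N, g k * (S (k + 1) - S k) - g N * S N + g 0 * S 0)
            + (g N - g (N + 1)) * S (N + 1) := by ring
      have hN : 0 ≤ g N - g (N + 1) := sub_nonneg.2 (hg N.le_succ)
      have hm : |(g N - g (N + 1)) * S (N + 1)| ≤ g N - g (N + 1) := by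
        rw [abs_mul, abs_of_nonneg hN]
        exact mul_le_of_le_one_right hN (hS _)
      rw [e]
      exact (abs_add_le _ _).trans (by linarith)
  have h1 := key N
  have h2 : |g N * S N| ≤ g N := by
    rw [abs_mul, abs_of_nonneg (hg0 N)]; exact mul_le_of_le_one_right (hg0 N) (hS N)
  have h3 : |g 0 * S 0| ≤ g 0 := by
    rw [abs_mul, abs_of_nonneg (hg0 0)]; exact mul_le_of_le_one_right (hg0 0) (hS 0)
  rw [abs_le] at *
  constructor <;> linarith

lemma abs_sum_antitone_mul_cos_le {g : ℕ → ℝ} (hg : Antitone g) (hg0 : ∀ k, 0 ≤ g k)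
    {x : ℝ} (hx : 0 < Real.sin x) (N : ℕ) :
    |∑ k ∈ Finset.range N, g k * Real.cos (2 * (((k : ℝ) + 1) * x))| ≤ g 0 / Real.sin x := by
  have h := abs_sum_antitone_mul_sub_le (S := fun k => Real.sin ((2 * (k : ℝ) + 1) * x)) hg hg0
    (fun k => Real.abs_sin_le_one _) N
  have e : ∀ k : ℕ, g k * (Real.sin ((2 * ((k + 1 : ℕ) : ℝ) + 1) * x)
      - Real.sin ((2 * (k : ℝ) + 1) * x))
      = 2 * Real.sin x * (g k * Real.cos (2 * (((k : ℝ) + 1) * x))) := by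
    intro k
    rw [Real.sin_sub_sin]
    push_cast
    rw [show ((2 * ((k : ℝ) + 1) + 1) * x - (2 * k + 1) * x) / 2 = x by ring,
      show ((2 * ((k : ℝ) + 1) + 1) * x + (2 * k + 1) * x) / 2 = 2 * ((k + 1) * x) by ring]
    ring
  simp_rw [e] at h
  rw [← Finset.mul_sum, abs_mul, abs_of_pos (by positivity)] at h
  rw [le_div_iff₀ hx]
  linarith

end TrigSums

section GaussianQuotient

/-- The function `y ↦ (1 - exp (-b y²)) / y²`, extended continuously to `y = 0`. -/
def gaussQuot (b y : ℝ) : ℝ := if y = 0 then b else (1 - Real.exp (-(b * y ^ 2))) / y ^ 2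

variable {b : ℝ}

lemma gaussQuot_zero : gaussQuot b 0 = b := by simp [gaussQuot]

lemma gaussQuot_of_ne {y : ℝ} (hy : y ≠ 0) :
    gaussQuot b y = (1 - Real.exp (-(b * y ^ 2))) / y ^ 2 := by simp [gaussQuot, hy]

lemma gaussQuot_nonneg (hb : 0 < b) (y : ℝ) : 0 ≤ gaussQuot b y := by
  rcases eq_or_ne y 0 with rfl | hy
  · rw [gaussQuot_zero]; exact hb.le
  · rw [gaussQuot_of_ne hy]
    have : Real.exp (-(b * y ^ 2)) ≤ 1 := Real.exp_le_one_iff.2 (by nlinarith [sq_nonneg y])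
    exact div_nonneg (by linarith) (sq_nonneg y)

lemma gaussQuot_le (y : ℝ) : gaussQuot b y ≤ b := by
  rcases eq_or_ne y 0 with rfl | hy
  · rw [gaussQuot_zero]
  · have hy2 : 0 < y ^ 2 := by positivity
    rw [gaussQuot_of_ne hy, div_le_iff₀ hy2]
    linarith [Real.one_sub_le_exp_neg (b * y ^ 2)]

lemma gaussQuot_le_inv_sq {y : ℝ} (hy : y ≠ 0) : gaussQuot b y ≤ 1 / y ^ 2 := by
  rw [gaussQuot_of_ne hy]
  gcongr
  linarith [Real.exp_pos (-(b * y ^ 2))]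

lemma antitoneOn_gaussQuot (hb : 0 < b) : AntitoneOn (gaussQuot b) (Set.Ici 0) := by
  intro y hy z hz hyz
  rcases eq_or_lt_of_le (show (0 : ℝ) ≤ y from hy) with rfl | hy0
  · rw [gaussQuot_zero]; exact gaussQuot_le z
  have hz0 : 0 < z := hy0.trans_le hyz
  have h := convexOn_exp.secant_mono (a := 0) (x := -(b * z ^ 2)) (y := -(b * y ^ 2))
    trivial trivial trivial (neg_ne_zero.2 (by positivity)) (neg_ne_zero.2 (by positivity)) (by gcongr)
  rw [gaussQuot_of_ne hy0.ne', gaussQuot_of_ne hz0.ne']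
  simp only [Real.exp_zero, sub_zero] at h
  have e : ∀ w : ℝ, 0 < w → (1 - Real.exp (-(b * w ^ 2))) / w ^ 2
      = b * ((Real.exp (-(b * w ^ 2)) - 1) / (-(b * w ^ 2))) := by
    intro w hw
    field_simp
    ring
  rw [e y hy0, e z hz0]
  gcongr

lemma integrableOn_gaussQuot (hb : 0 < b) : IntegrableOn (gaussQuot b) (Set.Ioi 0) := by
  have hm : Measurable (gaussQuot b) :=
    Measurable.ite (measurableSet_singleton 0) (by fun_prop) (by fun_prop)
  rw [← Set.Ioc_union_Ioi_eq_Ioi (zero_le_one' ℝ)]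
  refine IntegrableOn.union ?_ ?_
  · refine Integrable.mono' (integrable_const b) hm.aestronglyMeasurable (ae_of_all _ fun y => ?_)
    rw [Real.norm_of_nonneg (gaussQuot_nonneg hb y)]
    exact gaussQuot_le y
  · refine Integrable.mono' (integrableOn_Ioi_rpow_of_lt (a := -2) (by norm_num) one_pos)
      hm.aestronglyMeasurable ?_
    filter_upwards [ae_restrict_mem measurableSet_Ioi] with y hy
    have hy0 : (0 : ℝ) < y := one_pos.trans hy
    rw [Real.norm_of_nonneg (gaussQuot_nonneg hb y), Real.rpow_neg hy0.le]
    simpa using gaussQuot_le_inv_sq (b := b) hy0.ne'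

lemma integral_gaussQuot (hb : 0 < b) : ∫ y in Set.Ioi 0, gaussQuot b y = √(π * b) := by
  have hgauss : IntegrableOn (fun y : ℝ => Real.exp (-b * y ^ 2)) (Set.Ioi 0) :=
    (integrable_exp_neg_mul_sq hb).integrableOn
  have hint := (integrableOn_gaussQuot hb).sub (hgauss.const_mul (2 * b))
  have hval : ∀ y : ℝ, -(y * gaussQuot b y) = -((1 - Real.exp (-(b * y ^ 2))) / y) := by
    intro y
    rcases eq_or_ne y 0 with rfl | hy
    · simp
    · rw [gaussQuot_of_ne hy]; field_simp
  have key := integral_Ioi_of_hasDerivAt_of_tendsto (a := 0) (m := 0)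
    (f := fun y => -(y * gaussQuot b y))
    (f' := fun y => gaussQuot b y - 2 * b * Real.exp (-b * y ^ 2)) ?_ ?_ hint ?_
  · rw [integral_sub (integrableOn_gaussQuot hb) (hgauss.const_mul (2 * b)), integral_const_mul,
      integral_gaussian_Ioi] at key
    have hs : b * √(π / b) = √(π * b) := by
      rw [← Real.sqrt_sq hb.le, ← Real.sqrt_mul (sq_nonneg b), Real.sqrt_sq hb.le]
      congr 1
      field_simp
    simp only [zero_mul, neg_zero, sub_zero] at key
    linarith
  · refine ContinuousAt.continuousWithinAt ?_
    unfold ContinuousAt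
    simp only [zero_mul, neg_zero]
    refine squeeze_zero_norm (a := fun y => |y| * b) (fun y => ?_) ?_
    · rw [norm_neg, norm_mul, Real.norm_eq_abs, Real.norm_of_nonneg (gaussQuot_nonneg hb y)]
      gcongr
      exact gaussQuot_le y
    · exact Continuous.tendsto' (by fun_prop) _ _ (by simp)
  · intro y hy
    have hy0 : (0 : ℝ) < y := hy
    simp_rw [hval]
    have h1 : HasDerivAt (fun y : ℝ => -(b * y ^ 2)) (-(b * (2 * y))) y := by
      simpa using ((hasDerivAt_pow 2 y).const_mul b).fun_neg
    have h2 := ((h1.exp.const_sub 1).div (hasDerivAt_id y) hy0.ne').neg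
    refine h2.congr_deriv ?_
    rw [gaussQuot_of_ne hy0.ne', neg_mul]
    simp only [id]
    field_simp
    ring
  · simp_rw [hval]
    refine squeeze_zero_norm' (a := fun y => y⁻¹) ?_ tendsto_inv_atTop_zero
    filter_upwards [eventually_gt_atTop 0] with y hy
    have h1 : Real.exp (-(b * y ^ 2)) ≤ 1 := Real.exp_le_one_iff.2 (by nlinarith [sq_nonneg y])
    rw [norm_neg, norm_div, Real.norm_of_nonneg (by linarith), Real.norm_of_nonneg hy.le,
      ← one_div]
    gcongr
    linarith [Real.exp_pos (-(b * y ^ 2))]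

lemma summable_gaussQuot (hb : 0 < b) : Summable fun k : ℕ => gaussQuot b ((k : ℝ) + 1) := by
  have h := (antitoneOn_gaussQuot hb).summable_of_integrableOn_Ioi_zero
    (integrableOn_gaussQuot hb) (fun t _ => gaussQuot_nonneg hb t)
  simpa using (summable_nat_add_iff 1).2 h

lemma abs_tsum_gaussQuot_sub_le (hb : 0 < b) :
    |∑' k : ℕ, gaussQuot b ((k : ℝ) + 1) - √(π * b)| ≤ b := by
  have hs := (antitoneOn_gaussQuot hb).summable_of_integrableOn_Ioi_zero
    (integrableOn_gaussQuot hb) (fun t _ => gaussQuot_nonneg hb t)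
  have h1 := (antitoneOn_gaussQuot hb).tsum_add_one_le_integral
    (integrableOn_gaussQuot hb) (fun t _ => gaussQuot_nonneg hb t)
  have h2 := (antitoneOn_gaussQuot hb).integral_le_tsum hs (fun t _ => gaussQuot_nonneg hb t)
  rw [hs.tsum_eq_zero_add] at h2
  rw [integral_gaussQuot hb] at h1 h2
  simp only [Nat.cast_add, Nat.cast_one, Nat.cast_zero, gaussQuot_zero] at h1 h2
  rw [abs_le]
  constructor <;> linarith

lemma abs_tsum_gaussQuot_mul_cos_le (hb : 0 < b) {x : ℝ} (hx : 0 < Real.sin x) :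
    |∑' k : ℕ, gaussQuot b ((k : ℝ) + 1) * Real.cos (2 * (((k : ℝ) + 1) * x))|
      ≤ b / Real.sin x := by
  have hanti : Antitone fun k : ℕ => gaussQuot b ((k : ℝ) + 1) := fun i j hij =>
    antitoneOn_gaussQuot hb (Set.mem_Ici.2 (by positivity)) (Set.mem_Ici.2 (by positivity))
      (by gcongr)
  have hsum : Summable fun k : ℕ =>
      gaussQuot b ((k : ℝ) + 1) * Real.cos (2 * (((k : ℝ) + 1) * x)) := by
    refine Summable.of_norm_bounded (summable_gaussQuot hb) fun k => ?_
    rw [norm_mul, Real.norm_of_nonneg (gaussQuot_nonneg hb _)]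
    exact mul_le_of_le_one_right (gaussQuot_nonneg hb _) (Real.abs_cos_le_one _)
  refine le_of_tendsto hsum.hasSum.tendsto_sum_nat.abs (Eventually.of_forall fun N => ?_)
  refine (abs_sum_antitone_mul_cos_le hanti (fun k => gaussQuot_nonneg hb _) hx N).trans ?_
  gcongr
  exact gaussQuot_le _

/-- The series `∑ sin²(kx) (1 - exp (-b k²)) / k²` behaves like `√(π b) / 2` as `b → 0`. -/
lemma abs_tsum_sin_sq_mul_gaussQuot_sub_le (hb : 0 < b) {x : ℝ} (hx : 0 < Real.sin x) :
    |∑' k : ℕ, Real.sin (((k : ℝ) + 1) * x) ^ 2 * gaussQuot b ((k : ℝ) + 1) - √(π * b) / 2|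
      ≤ (b + b / Real.sin x) / 2 := by
  have hsum : Summable fun k : ℕ =>
      gaussQuot b ((k : ℝ) + 1) * Real.cos (2 * (((k : ℝ) + 1) * x)) := by
    refine Summable.of_norm_bounded (summable_gaussQuot hb) fun k => ?_
    rw [norm_mul, Real.norm_of_nonneg (gaussQuot_nonneg hb _)]
    exact mul_le_of_le_one_right (gaussQuot_nonneg hb _) (Real.abs_cos_le_one _)
  have e : ∀ k : ℕ, Real.sin (((k : ℝ) + 1) * x) ^ 2 * gaussQuot b ((k : ℝ) + 1)
      = (1 / 2) * (gaussQuot b ((k : ℝ) + 1)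
        - gaussQuot b ((k : ℝ) + 1) * Real.cos (2 * (((k : ℝ) + 1) * x))) := by
    intro k
    rw [Real.sin_sq_eq_half_sub]
    ring
  simp_rw [e]
  rw [tsum_mul_left, (summable_gaussQuot hb).tsum_sub hsum]
  have h1 := abs_tsum_gaussQuot_sub_le hb
  have h2 := abs_tsum_gaussQuot_mul_cos_le hb hx
  rw [abs_le] at *
  constructor <;> linarith

end GaussianQuotient

section HeatCovariance

variable {θ σ x s t s' t' c h : ℝ}

lemma summable_one_div_succ_sq : Summable fun k : ℕ => 1 / ((k : ℝ) + 1) ^ 2 := by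
  simpa using (summable_nat_add_iff 1).2 (Real.summable_one_div_nat_pow.2 one_lt_two)

lemma sin_sq_div_succ_sq_le (x : ℝ) (k : ℕ) :
    Real.sin (((k : ℝ) + 1) * x) ^ 2 / ((k : ℝ) + 1) ^ 2 ≤ 1 / ((k : ℝ) + 1) ^ 2 := by
  gcongr
  exact Real.sin_sq_le_one _

lemma hasSum_heatCovTime (hθ : 0 < θ) (hs : 0 ≤ s) (ht : 0 ≤ t) :
    HasSum (fun k : ℕ => (σ ^ 2 / (θ * π)) * (Real.sin (((k : ℝ) + 1) * x) ^ 2 / ((k : ℝ) + 1) ^ 2 *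
      (Real.exp (-(θ * ((k : ℝ) + 1) ^ 2 * |t - s|)) -
        Real.exp (-(θ * ((k : ℝ) + 1) ^ 2 * (t + s))))))
      (heatCovTime θ σ x s t) := by
  refine (Summable.hasSum ?_).mul_left _
  refine Summable.of_norm_bounded summable_one_div_succ_sq fun k => ?_
  have h1 : Real.exp (-(θ * ((k : ℝ) + 1) ^ 2 * |t - s|)) ≤ 1 :=
    Real.exp_le_one_iff.2 (neg_nonpos.2 (by positivity))
  have h2 : Real.exp (-(θ * ((k : ℝ) + 1) ^ 2 * (t + s))) ≤ 1 :=
    Real.exp_le_one_iff.2 (neg_nonpos.2 (by positivity))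
  have h3 := Real.exp_pos (-(θ * ((k : ℝ) + 1) ^ 2 * |t - s|))
  have h4 := Real.exp_pos (-(θ * ((k : ℝ) + 1) ^ 2 * (t + s)))
  rw [norm_mul, Real.norm_of_nonneg (by positivity), Real.norm_eq_abs]
  exact (mul_le_of_le_one_right (by positivity) (abs_le.2 ⟨by linarith, by linarith⟩)).trans
    (sin_sq_div_succ_sq_le x k)

lemma heatCovTime_comm : heatCovTime θ σ x s t = heatCovTime θ σ x t s := by
  simp only [heatCovTime, abs_sub_comm t s, add_comm t s]

lemma heatCovTime_nonneg (hθ : 0 < θ) (hs : 0 ≤ s) (ht : 0 ≤ t) :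
    0 ≤ heatCovTime θ σ x s t := by
  refine mul_nonneg (by positivity) (tsum_nonneg fun k => mul_nonneg (by positivity) ?_)
  rw [sub_nonneg]
  have : |t - s| ≤ t + s := abs_le.2 ⟨by linarith, by linarith⟩
  gcongr

lemma heatCovTime_increments_nonpos (hθ : 0 < θ) (hs : 0 ≤ s) (hss : s ≤ s')
    (hst : s' ≤ t) (htt : t ≤ t') :
    heatCovTime θ σ x s' t' - heatCovTime θ σ x s' t - heatCovTime θ σ x s t'
      + heatCovTime θ σ x s t ≤ 0 := by
  have hs' : 0 ≤ s' := hs.trans hss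
  have ht : 0 ≤ t := hs'.trans hst
  have ht' : 0 ≤ t' := ht.trans htt
  have hC := fun p q => @hasSum_heatCovTime θ σ x p q
  have H := (((hC s' t' hθ hs' ht').sub (hC s' t hθ hs' ht)).sub (hC s t' hθ hs ht')).add
    (hC s t hθ hs ht)
  refine hasSum_le (fun k => ?_) H hasSum_zero
  rw [abs_of_nonneg (by linarith : 0 ≤ t' - s'), abs_of_nonneg (by linarith : 0 ≤ t - s'),
    abs_of_nonneg (by linarith : 0 ≤ t' - s), abs_of_nonneg (by linarith : 0 ≤ t - s)]
  set a := θ * ((k : ℝ) + 1) ^ 2 with ha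
  have ha0 : 0 ≤ a := by positivity
  set w := Real.sin (((k : ℝ) + 1) * x) ^ 2 / ((k : ℝ) + 1) ^ 2
  have hw : 0 ≤ w := by positivity
  have e1 : ∀ p q, Real.exp (-(a * (q - p))) = Real.exp (-(a * q)) * Real.exp (a * p) := by
    intro p q; rw [← Real.exp_add]; ring_nf
  have e2 : ∀ p q, Real.exp (-(a * (q + p))) = Real.exp (-(a * q)) * Real.exp (-(a * p)) := by
    intro p q; rw [← Real.exp_add]; ring_nf
  simp only [e1, e2]
  have m1 : Real.exp (-(a * t')) ≤ Real.exp (-(a * t)) := by gcongr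
  have m2 : Real.exp (a * s) ≤ Real.exp (a * s') := by gcongr
  have m3 : Real.exp (-(a * s')) ≤ Real.exp (-(a * s)) := by gcongr
  have hK : 0 ≤ σ ^ 2 / (θ * π) := by positivity
  have hprod := mul_nonneg (mul_nonneg hK hw) (mul_nonneg (sub_nonneg.2 m1)
    (add_nonneg (sub_nonneg.2 m2) (sub_nonneg.2 m3)))
  linear_combination hprod

/-- The variance of the increment over a time step `h` of the stationary process that agrees with
the solution of the stochastic heat equation up to a smooth perturbation. -/
def stationaryIncrementVar (θ σ x h : ℝ) : ℝ :=
  2 * (σ ^ 2 / (θ * π)) * ∑' k : ℕ,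
    Real.sin (((k : ℝ) + 1) * x) ^ 2 * gaussQuot (θ * h) ((k : ℝ) + 1)

lemma hasSum_stationaryIncrementVar (hθ : 0 < θ) (hh : 0 < h) :
    HasSum (fun k : ℕ => 2 * (σ ^ 2 / (θ * π)) *
      (Real.sin (((k : ℝ) + 1) * x) ^ 2 * gaussQuot (θ * h) ((k : ℝ) + 1)))
      (stationaryIncrementVar θ σ x h) := by
  refine (Summable.hasSum ?_).mul_left _
  have hb : 0 < θ * h := by positivity
  refine Summable.of_norm_bounded (summable_gaussQuot hb) fun k => ?_
  rw [norm_mul, Real.norm_of_nonneg (gaussQuot_nonneg hb _), Real.norm_of_nonneg (sq_nonneg _)]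
  exact mul_le_of_le_one_left (gaussQuot_nonneg hb _) (Real.sin_sq_le_one _)

lemma exp_neg_sub_exp_neg_sq_le {a : ℝ} (ha : 0 < a) (hc : 0 < c) (hct : c ≤ t) (htt : t ≤ t') :
    (Real.exp (-(a * t)) - Real.exp (-(a * t'))) ^ 2 ≤ (t' - t) / (2 * c) := by
  have hd : 0 ≤ a * (t' - t) := mul_nonneg ha.le (sub_nonneg.2 htt)
  have e : Real.exp (-(a * t)) - Real.exp (-(a * t'))
      = Real.exp (-(a * t)) * (1 - Real.exp (-(a * (t' - t)))) := by
    rw [mul_sub, mul_one, ← Real.exp_add]; ring_nf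
  have h1 : Real.exp (-(a * t)) ^ 2 ≤ 1 / (2 * (a * c)) := by
    have hle : 2 * (a * c) ≤ Real.exp (2 * (a * t)) :=
      (by gcongr : 2 * (a * c) ≤ 2 * (a * t)).trans
        (by linarith [Real.add_one_le_exp (2 * (a * t))])
    rw [← Real.exp_nat_mul, show ((2 : ℕ) : ℝ) * -(a * t) = -(2 * (a * t)) by push_cast; ring,
      Real.exp_neg, ← one_div]
    gcongr
  have h2 : (1 - Real.exp (-(a * (t' - t)))) ^ 2 ≤ a * (t' - t) := by
    have p1 := Real.exp_pos (-(a * (t' - t)))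
    have p2 : Real.exp (-(a * (t' - t))) ≤ 1 := Real.exp_le_one_iff.2 (by linarith)
    nlinarith [Real.one_sub_le_exp_neg (a * (t' - t))]
  rw [e, mul_pow]
  calc _ ≤ 1 / (2 * (a * c)) * (a * (t' - t)) := by gcongr
    _ = (t' - t) / (2 * c) := by field_simp

lemma hasSum_stationaryIncrementVar_sub (hθ : 0 < θ) (ht : 0 ≤ t) (htt : t < t') :
    HasSum (fun k : ℕ => (σ ^ 2 / (θ * π)) *
      (Real.sin (((k : ℝ) + 1) * x) ^ 2 / ((k : ℝ) + 1) ^ 2 *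
        (Real.exp (-(θ * ((k : ℝ) + 1) ^ 2 * t)) - Real.exp (-(θ * ((k : ℝ) + 1) ^ 2 * t'))) ^ 2))
      (stationaryIncrementVar θ σ x (t' - t) - (heatCovTime θ σ x t' t'
        - 2 * heatCovTime θ σ x t t' + heatCovTime θ σ x t t)) := by
  have ht' : 0 ≤ t' := ht.trans htt.le
  have hC := fun p q => @hasSum_heatCovTime θ σ x p q
  refine ((hasSum_stationaryIncrementVar hθ (sub_pos.2 htt)).sub
    (((hC t' t' hθ ht' ht').sub ((hC t t' hθ ht ht').mul_left 2)).add
      (hC t t hθ ht ht))).congr_fun fun k => ?_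
  have hk : ((k : ℝ) + 1) ≠ 0 := by positivity
  rw [gaussQuot_of_ne hk, sub_self, sub_self, abs_zero, abs_of_pos (sub_pos.2 htt)]
  simp only [mul_zero, neg_zero, Real.exp_zero]
  set a := θ * ((k : ℝ) + 1) ^ 2 with ha
  rw [show θ * (t' - t) * ((k : ℝ) + 1) ^ 2 = a * (t' - t) by rw [ha]; ring,
    show -(a * (t' + t')) = -(a * t') + -(a * t') by ring,
    show -(a * (t + t)) = -(a * t) + -(a * t) by ring,
    show -(a * (t' + t)) = -(a * t') + -(a * t) by ring]
  simp only [Real.exp_add]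
  ring

lemma heatCovTime_increment_le (hθ : 0 < θ) (ht : 0 ≤ t) (htt : t < t') :
    heatCovTime θ σ x t' t' - 2 * heatCovTime θ σ x t t' + heatCovTime θ σ x t t
      ≤ stationaryIncrementVar θ σ x (t' - t) :=
  sub_nonneg.1 <| (hasSum_stationaryIncrementVar_sub hθ ht htt).nonneg fun k => by positivity

lemma stationaryIncrementVar_sub_le (hθ : 0 < θ) (hc : 0 < c) (hct : c ≤ t) (htt : t < t') :
    stationaryIncrementVar θ σ x (t' - t) - (heatCovTime θ σ x t' t'
      - 2 * heatCovTime θ σ x t t' + heatCovTime θ σ x t t)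
      ≤ (σ ^ 2 / (θ * π)) * ((∑' k : ℕ, 1 / ((k : ℝ) + 1) ^ 2) / (2 * c)) * (t' - t) := by
  have h1 := (summable_one_div_succ_sq.hasSum.mul_right ((t' - t) / (2 * c))).mul_left
    (σ ^ 2 / (θ * π))
  refine (hasSum_le (fun k => ?_)
    (hasSum_stationaryIncrementVar_sub hθ (hc.le.trans hct) htt) h1).trans_eq (by ring)
  gcongr
  · exact Real.sin_sq_le_one _
  · exact exp_neg_sub_exp_neg_sq_le (by positivity) hc hct htt.le

lemma abs_stationaryIncrementVar_sub_le (hθ : 0 < θ) (hh : 0 < h) (hx : 0 < Real.sin x) :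
    |stationaryIncrementVar θ σ x h - (σ ^ 2 / (θ * π)) * √(π * θ) * √h|
      ≤ (σ ^ 2 / (θ * π)) * (θ + θ / Real.sin x) * h := by
  have h1 := abs_tsum_sin_sq_mul_gaussQuot_sub_le (b := θ * h) (by positivity) hx
  rw [← mul_assoc π, Real.sqrt_mul (by positivity)] at h1
  have hK : 0 ≤ 2 * (σ ^ 2 / (θ * π)) := by positivity
  have h2 := mul_le_mul_of_nonneg_left h1 hK
  rw [← abs_of_nonneg hK, ← abs_mul, abs_of_nonneg hK] at h2
  rw [stationaryIncrementVar]
  calc _ = _ := by congr 1; ring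
    _ ≤ _ := h2
    _ = _ := by ring

end HeatCovariance

section GaussianField

variable {Ω : Type*} [MeasurableSpace Ω] {P : Measure Ω} {u : ℝ → Ω → ℝ} {S : Set ℝ}
  {C : ℝ → ℝ → ℝ} {s t r q : ℝ}

namespace IsCenteredGaussianField

lemma isCenteredGaussianPair_sub (hu : IsCenteredGaussianField P u S C)
    (hs : s ∈ S) (hr : r ∈ S) (ht : t ∈ S) (hq : q ∈ S) :
    IsCenteredGaussianPair P (fun ω => u s ω - u r ω) (fun ω => u t ω - u q ω) := by
  intro a b
  have h := hu 4 ![s, r, t, q] (by simp [Fin.forall_fin_succ, *]) ![a, -a, b, -b]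
  refine ⟨_, Eq.trans ?_ h⟩
  congr 1
  ext ω
  simp [Fin.sum_univ_succ]
  ring

lemma map_eq_gaussianReal (hu : IsCenteredGaussianField P u S C) (hs : s ∈ S) :
    P.map (u s) = gaussianReal 0 (C s s).toNNReal := by
  simpa using hu 1 ![s] (by simpa using hs) ![1]

lemma map_add_eq_gaussianReal (hu : IsCenteredGaussianField P u S C) (hs : s ∈ S) (ht : t ∈ S) :
    P.map (fun ω => u s ω + u t ω)
      = gaussianReal 0 (C s s + C s t + (C t s + C t t)).toNNReal := by
  simpa [Fin.sum_univ_succ] using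
    hu 2 ![s, t] (by simp [Fin.forall_fin_succ, *]) ![1, 1]

lemma isCenteredGaussianPair (hu : IsCenteredGaussianField P u S C) (hs : s ∈ S) (ht : t ∈ S) :
    IsCenteredGaussianPair P (u s) (u t) := by
  intro a b
  have h := hu 2 ![s, t] (by simp [Fin.forall_fin_succ, *]) ![a, b]
  refine ⟨_, Eq.trans ?_ h⟩
  congr 1
  ext ω
  simp [Fin.sum_univ_succ]

lemma integrable_mul (hu : IsCenteredGaussianField P u S C) (hs : s ∈ S) (ht : t ∈ S) :
    Integrable (fun ω => u s ω * u t ω) P :=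
  ((hu.isCenteredGaussianPair hs ht).memLp_left (p := 2) (by simp)).integrable_mul
    ((hu.isCenteredGaussianPair hs ht).memLp_right (p := 2) (by simp))

lemma integral_mul (hu : IsCenteredGaussianField P u S C)
    (hC : ∀ s ∈ S, ∀ t ∈ S, 0 ≤ C s t) (hsymm : ∀ s t, C s t = C t s) (hs : s ∈ S) (ht : t ∈ S) :
    ∫ ω, u s ω * u t ω ∂P = C s t := by
  have h1 := integral_sq_of_map_eq_gaussianReal (hu.map_eq_gaussianReal hs)
  have h2 := integral_sq_of_map_eq_gaussianReal (hu.map_eq_gaussianReal ht)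
  have h3 := integral_sq_of_map_eq_gaussianReal (hu.map_add_eq_gaussianReal hs ht)
  have h4 := (hu.isCenteredGaussianPair hs ht).integral_sq 1 1
  have c1 := hC s hs s hs
  have c2 := hC s hs t ht
  have c3 := hC t ht t ht
  rw [hsymm t s] at h3
  rw [Real.coe_toNNReal _ (by positivity)] at h1 h2 h3
  simp only [one_mul] at h4
  linarith

lemma integral_sub_mul_sub (hu : IsCenteredGaussianField P u S C)
    (hC : ∀ s ∈ S, ∀ t ∈ S, 0 ≤ C s t) (hsymm : ∀ s t, C s t = C t s)
    (hs : s ∈ S) (hr : r ∈ S) (ht : t ∈ S) (hq : q ∈ S) :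
    ∫ ω, (u s ω - u r ω) * (u t ω - u q ω) ∂P = C s t - C s q - C r t + C r q := by
  have e : ∀ ω, (u s ω - u r ω) * (u t ω - u q ω)
      = (u s ω * u t ω - u s ω * u q ω) - (u r ω * u t ω - u r ω * u q ω) := fun ω => by ring
  have i1 := hu.integrable_mul hs ht
  have i2 := hu.integrable_mul hs hq
  have i3 := hu.integrable_mul hr ht
  have i4 := hu.integrable_mul hr hq
  simp_rw [e]
  have i12 : Integrable (fun ω => u s ω * u t ω - u s ω * u q ω) P := i1.sub i2
  have i34 : Integrable (fun ω => u r ω * u t ω - u r ω * u q ω) P := i3.sub i4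
  rw [integral_sub i12 i34, integral_sub i1 i2, integral_sub i3 i4,
    hu.integral_mul hC hsymm hs ht, hu.integral_mul hC hsymm hs hq,
    hu.integral_mul hC hsymm hr ht, hu.integral_mul hC hsymm hr hq]
  ring

end IsCenteredGaussianField

/-- For jointly Gaussian centered variables with non-positive correlations, the sum of fourth
powers concentrates around its mean. -/
lemma integral_sum_pow_four_sub_sq_le [IsProbabilityMeasure P] {X : ℕ → Ω → ℝ} {n : ℕ} {V : ℝ}
    (hX : ∀ i < n, ∀ j < n, IsCenteredGaussianPair P (X i) (X j))
    (hV : ∀ i < n, ∫ ω, X i ω ^ 2 ∂P ≤ V)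
    (hneg : ∀ i < n, ∀ j < n, i ≠ j → ∫ ω, X i ω * X j ω ∂P ≤ 0) :
    Integrable (fun ω => (∑ i ∈ Finset.range n, X i ω ^ 4
        - ∑ i ∈ Finset.range n, 3 * (∫ ω, X i ω ^ 2 ∂P) ^ 2) ^ 2) P ∧
      ∫ ω, (∑ i ∈ Finset.range n, X i ω ^ 4
        - ∑ i ∈ Finset.range n, 3 * (∫ ω, X i ω ^ 2 ∂P) ^ 2) ^ 2 ∂P ≤ 192 * n * V ^ 4 := by
  rcases Nat.eq_zero_or_pos n with rfl | hn
  · simp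
  have hV0 : 0 ≤ V := (integral_nonneg fun ω => sq_nonneg _).trans (hV 0 hn)
  set v : ℕ → ℝ := fun i => ∫ ω, X i ω ^ 2 ∂P with hv
  set R : ℕ → ℕ → ℝ := fun i j => ∫ ω, X i ω * X j ω ∂P with hR
  have hv0 : ∀ i, 0 ≤ v i := fun i => integral_nonneg fun ω => sq_nonneg _
  have hRii : ∀ i, R i i = v i := fun i => by simp only [hR, hv, pow_two]
  have h4 : ∀ i < n, Integrable (fun ω => X i ω ^ 4) P := fun i hi => by
    refine (((hX i hi i hi).memLp_left (p := (4 : ℕ)) (by simp)).integrable_norm_pow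
      (by simp)).congr (ae_of_all _ fun ω => ?_)
    simp [Even.pow_abs (show Even 4 by decide)]
  have h4v : ∀ i < n, ∫ ω, X i ω ^ 4 ∂P = 3 * v i ^ 2 := fun i hi =>
    integral_pow_four_of_map_eq_gaussianReal (hX i hi i hi).left.choose_spec
  have hexp : ∀ ω, (∑ i ∈ Finset.range n, X i ω ^ 4 - ∑ i ∈ Finset.range n, 3 * v i ^ 2) ^ 2
      = ∑ i ∈ Finset.range n, ∑ j ∈ Finset.range n, ((X i ω ^ 4 * X j ω ^ 4
        - 3 * v j ^ 2 * X i ω ^ 4) - (3 * v i ^ 2 * X j ω ^ 4 - 3 * v i ^ 2 * (3 * v j ^ 2))) := by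
    intro ω
    rw [← Finset.sum_sub_distrib, sq, Finset.sum_mul_sum]
    refine Finset.sum_congr rfl fun i _ => Finset.sum_congr rfl fun j _ => ?_
    ring
  have hI1 : ∀ i < n, ∀ j < n, Integrable (fun ω => X i ω ^ 4 * X j ω ^ 4
      - 3 * v j ^ 2 * X i ω ^ 4) P := fun i hi j hj =>
    (hX i hi j hj).integrable_pow_four_mul_pow_four.sub ((h4 i hi).const_mul _)
  have hI2 : ∀ i < n, ∀ j < n, Integrable (fun ω => 3 * v i ^ 2 * X j ω ^ 4
      - 3 * v i ^ 2 * (3 * v j ^ 2)) P := fun i hi j hj =>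
    ((h4 j hj).const_mul _).sub (integrable_const _)
  have hI : ∀ i ∈ Finset.range n, ∀ j ∈ Finset.range n, Integrable (fun ω => (X i ω ^ 4 * X j ω ^ 4
      - 3 * v j ^ 2 * X i ω ^ 4) - (3 * v i ^ 2 * X j ω ^ 4 - 3 * v i ^ 2 * (3 * v j ^ 2))) P :=
    fun i hi j hj => (hI1 i (Finset.mem_range.1 hi) j (Finset.mem_range.1 hj)).sub
      (hI2 i (Finset.mem_range.1 hi) j (Finset.mem_range.1 hj))
  change Integrable (fun ω => (∑ i ∈ Finset.range n, X i ω ^ 4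
      - ∑ i ∈ Finset.range n, 3 * v i ^ 2) ^ 2) P ∧
    ∫ ω, (∑ i ∈ Finset.range n, X i ω ^ 4 - ∑ i ∈ Finset.range n, 3 * v i ^ 2) ^ 2 ∂P ≤ _
  simp_rw [hexp]
  refine ⟨integrable_finsetSum _ fun i hi => integrable_finsetSum _ (hI i hi), ?_⟩
  rw [integral_finsetSum _ fun i hi => integrable_finsetSum _ (hI i hi)]
  have hRabs : ∀ i < n, ∀ j < n, |R i j| ≤ V := fun i hi j hj => by
    have := (hX i hi j hj).two_mul_abs_integral_mul_le
    have h1 := hV i hi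
    have h2 := hV j hj
    simp only [hR]
    linarith
  have hterm : ∀ i ∈ Finset.range n, ∫ ω, ∑ j ∈ Finset.range n, ((X i ω ^ 4 * X j ω ^ 4
      - 3 * v j ^ 2 * X i ω ^ 4) - (3 * v i ^ 2 * X j ω ^ 4 - 3 * v i ^ 2 * (3 * v j ^ 2))) ∂P
      ≤ ∑ j ∈ Finset.range n, 96 * V ^ 3 * ((if i = j then 2 * V else 0) - R i j) := by
    intro i hi
    rw [integral_finsetSum _ (hI i hi)]
    refine Finset.sum_le_sum fun j hj => ?_
    rw [Finset.mem_range] at hi hj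
    rw [integral_sub (hI1 i hi j hj) (hI2 i hi j hj),
      integral_sub (hX i hi j hj).integrable_pow_four_mul_pow_four ((h4 i hi).const_mul _),
      integral_sub ((h4 j hj).const_mul _) (integrable_const _), integral_const_mul,
      integral_const_mul, h4v i hi, h4v j hj, (hX i hi j hj).integral_pow_four_mul_pow_four]
    simp only [integral_const, probReal_univ, one_smul]
    have hb : |R i j| ≤ (if i = j then 2 * V else 0) - R i j := by
      split_ifs with hij
      · subst hij
        rw [hRii, abs_of_nonneg (hv0 i)]
        linarith [hV i hi]
      · rw [abs_of_nonpos (hneg i hi j hj hij)]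
        linarith
    have hr := hRabs i hi j hj
    have b1 : v i * v j ≤ V * V := mul_le_mul (hV i hi) (hV j hj) (hv0 j) hV0
    have b2 : R i j ^ 2 ≤ V * |R i j| := by
      rw [← sq_abs, sq]; gcongr
    have b3 : R i j ^ 4 ≤ V ^ 3 * |R i j| := by
      rw [← Even.pow_abs (show Even 4 by decide), pow_succ]; gcongr
    have b4 : v i * v j * R i j ^ 2 ≤ (V * V) * (V * |R i j|) :=
      mul_le_mul b1 b2 (sq_nonneg _) (by positivity)
    have b5 : V ^ 3 * |R i j| ≤ V ^ 3 * ((if i = j then 2 * V else 0) - R i j) := by gcongr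
    change 9 * v i ^ 2 * v j ^ 2 + 72 * v i * v j * R i j ^ 2 + 24 * R i j ^ 4
      - 3 * v j ^ 2 * (3 * v i ^ 2) - (3 * v i ^ 2 * (3 * v j ^ 2) - 3 * v i ^ 2 * (3 * v j ^ 2))
      ≤ _
    nlinarith
  refine (Finset.sum_le_sum hterm).trans ?_
  have hXX : ∀ i ∈ Finset.range n, ∀ j ∈ Finset.range n,
      Integrable (fun ω => X i ω * X j ω) P := fun i hi j hj => by
    rw [Finset.mem_range] at hi hj
    exact ((hX i hi j hj).memLp_left (p := 2) (by simp)).integrable_mul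
      ((hX i hi j hj).memLp_right (p := 2) (by simp))
  have hsum : 0 ≤ ∑ i ∈ Finset.range n, ∑ j ∈ Finset.range n, R i j := by
    have e : ∑ i ∈ Finset.range n, ∑ j ∈ Finset.range n, R i j
        = ∫ ω, (∑ i ∈ Finset.range n, X i ω) ^ 2 ∂P := by
      simp_rw [sq, Finset.sum_mul_sum]
      rw [integral_finsetSum _ fun i hi => integrable_finsetSum _ (hXX i hi)]
      exact Finset.sum_congr rfl fun i hi => (integral_finsetSum _ (hXX i hi)).symm
    rw [e]
    exact integral_nonneg fun ω => sq_nonneg _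
  have hdiag : ∑ i ∈ Finset.range n, ∑ j ∈ Finset.range n, (if i = j then 2 * V else 0)
      = n * (2 * V) := by
    rw [Finset.sum_congr rfl fun i hi => by rw [Finset.sum_ite_eq, if_pos hi]]
    simp
  simp_rw [← Finset.mul_sum, Finset.sum_sub_distrib]
  rw [hdiag]
  have := mul_nonneg (by positivity : 0 ≤ 96 * V ^ 3) hsum
  nlinarith

end GaussianField

section Convergence

variable {Ω : Type*} [MeasurableSpace Ω] {P : Measure Ω}

/-- Convergence in probability to a constant from the decay of the centered second moments and
the convergence of the centering constants. -/
lemma tendstoInMeasure_const_of_tendsto_integral_sq [IsFiniteMeasure P] {Z : ℕ → Ω → ℝ}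
    {m : ℕ → ℝ} {M : ℝ} (hi : ∀ᶠ n in atTop, Integrable (fun ω => (Z n ω - m n) ^ 2) P)
    (h : Tendsto (fun n => ∫ ω, (Z n ω - m n) ^ 2 ∂P) atTop (nhds 0))
    (hm : Tendsto m atTop (nhds M)) : TendstoInMeasure P Z atTop fun _ => M := by
  rw [tendstoInMeasure_iff_measureReal_dist]
  intro ε hε
  have hb : Tendsto (fun n => (∫ ω, (Z n ω - m n) ^ 2 ∂P) / (ε / 2) ^ 2) atTop (nhds 0) := by
    simpa using h.div_const ((ε / 2) ^ 2)
  refine squeeze_zero' (Eventually.of_forall fun n => measureReal_nonneg) ?_ hb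
  filter_upwards [hi, Metric.tendsto_nhds.1 hm (ε / 2) (by positivity)] with n hn hmn
  rw [le_div_iff₀ (by positivity), mul_comm]
  refine le_trans ?_ (mul_meas_ge_le_integral_of_nonneg (ae_of_all _ fun ω => sq_nonneg _) hn
    ((ε / 2) ^ 2))
  refine mul_le_mul_of_nonneg_left (measureReal_mono fun ω hω => ?_) (by positivity)
  simp only [Set.mem_ofPred_eq] at hω ⊢
  rw [← sq_abs (Z n ω - m n)]
  have h1 := dist_triangle (Z n ω) (m n) M
  have h2 : dist (Z n ω) (m n) = |Z n ω - m n| := Real.dist_eq _ _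
  gcongr
  linarith

/-- Continuous mapping at a constant limit for convergence in measure. -/
lemma TendstoInMeasure.comp_continuousAt_const {ι E F : Type*} [PseudoMetricSpace E]
    [PseudoMetricSpace F] {l : Filter ι} {Z : ι → Ω → E} {m : E} {g : E → F}
    (h : TendstoInMeasure P Z l fun _ => m) (hg : ContinuousAt g m) :
    TendstoInMeasure P (fun n ω => g (Z n ω)) l fun _ => g m := by
  rw [tendstoInMeasure_iff_dist] at h ⊢
  intro ε hε
  obtain ⟨δ, hδ, hgδ⟩ := Metric.continuousAt_iff.1 hg ε hε
  refine tendsto_of_tendsto_of_tendsto_of_le_of_le tendsto_const_nhds (h δ hδ)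
    (fun _ => zero_le) fun n => measure_mono fun ω hω => ?_
  simp only [Set.mem_ofPred_eq] at hω ⊢
  by_contra! hlt
  exact (hgδ hlt).not_ge hω

end Convergence

section Asymptotics

variable {V : ℝ → ℝ} {δ L A : ℝ}

lemma tendsto_div_natCast_zero (δ : ℝ) : Tendsto (fun n : ℕ => δ / n) atTop (nhds 0) :=
  tendsto_const_nhds.div_atTop tendsto_natCast_atTop_atTop

lemma tendsto_div_sqrt_step (hδ : 0 < δ) (hV : ∀ h, 0 < h → |V h - L * √h| ≤ A * h) :
    Tendsto (fun n : ℕ => V (δ / n) / √(δ / n)) atTop (nhds L) := by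
  have h0 : Tendsto (fun n : ℕ => A * √(δ / n)) atTop (nhds 0) := by
    simpa using ((Real.continuous_sqrt.tendsto 0).comp (tendsto_div_natCast_zero δ)).const_mul A
  rw [tendsto_iff_norm_sub_tendsto_zero]
  refine squeeze_zero' (Eventually.of_forall fun n => norm_nonneg _) ?_ h0
  filter_upwards [eventually_gt_atTop 0] with n hn
  have hh : 0 < δ / n := by positivity
  have hs := Real.sqrt_pos.2 hh
  have e : V (δ / n) / √(δ / n) - L = (V (δ / n) - L * √(δ / n)) / √(δ / n) := by
    field_simp
  rw [e, Real.norm_eq_abs, abs_div, abs_of_pos hs, div_le_iff₀ hs, mul_assoc,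
    Real.mul_self_sqrt hh.le]
  exact hV _ hh

lemma tendsto_step_zero (hδ : 0 < δ) (hV : ∀ h, 0 < h → |V h - L * √h| ≤ A * h) :
    Tendsto (fun n : ℕ => V (δ / n)) atTop (nhds 0) := by
  have h := (tendsto_div_sqrt_step hδ hV).mul
    ((Real.continuous_sqrt.tendsto 0).comp (tendsto_div_natCast_zero δ))
  rw [Real.sqrt_zero, mul_zero] at h
  refine h.congr' ?_
  filter_upwards [eventually_gt_atTop 0] with n hn
  exact div_mul_cancel₀ _ (Real.sqrt_pos.2 (by positivity)).ne'

lemma tendsto_natCast_mul_sq_step (hδ : 0 < δ) (hV : ∀ h, 0 < h → |V h - L * √h| ≤ A * h) :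
    Tendsto (fun n : ℕ => n * V (δ / n) ^ 2) atTop (nhds (δ * L ^ 2)) := by
  refine (((tendsto_div_sqrt_step hδ hV).pow 2).const_mul δ).congr' ?_
  filter_upwards [eventually_gt_atTop 0] with n hn
  rw [div_pow, Real.sq_sqrt (by positivity)]
  field_simp

lemma tendsto_natCast_mul_pow_four_step (hδ : 0 < δ)
    (hV : ∀ h, 0 < h → |V h - L * √h| ≤ A * h) :
    Tendsto (fun n : ℕ => n * V (δ / n) ^ 4) atTop (nhds 0) := by
  have h := (tendsto_natCast_mul_sq_step hδ hV).mul ((tendsto_step_zero hδ hV).pow 2)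
  rw [zero_pow two_ne_zero, mul_zero] at h
  exact h.congr fun n => by ring

lemma tendsto_sum_three_mul_sq (hδ : 0 < δ) (hV : ∀ h, 0 < h → |V h - L * √h| ≤ A * h)
    {D : ℝ} {v : ℕ → ℕ → ℝ} (hv0 : ∀ n i : ℕ, i < n → 0 ≤ v n i)
    (hv : ∀ n i : ℕ, i < n → v n i ≤ V (δ / n))
    (hvD : ∀ n i : ℕ, i < n → V (δ / n) - v n i ≤ D * (δ / n)) :
    Tendsto (fun n => ∑ i ∈ Finset.range n, 3 * v n i ^ 2) atTop (nhds (3 * (δ * L ^ 2))) := by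
  have hmain := (tendsto_natCast_mul_sq_step hδ hV).const_mul 3
  have hlow : Tendsto (fun n : ℕ => 3 * (n * V (δ / n) ^ 2) - 6 * (D * δ) * V (δ / n)) atTop
      (nhds (3 * (δ * L ^ 2))) := by
    simpa using hmain.sub ((tendsto_step_zero hδ hV).const_mul (6 * (D * δ)))
  refine tendsto_of_tendsto_of_tendsto_of_le_of_le' hlow hmain ?_ ?_
  · filter_upwards [eventually_gt_atTop 0] with n hn
    have e : 3 * (n * V (δ / n) ^ 2) - 6 * (D * δ) * V (δ / n)
        = ∑ _i ∈ Finset.range n,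
          (3 * V (δ / n) ^ 2 - 6 * (D * (δ / n)) * V (δ / n)) := by
      rw [Finset.sum_const, Finset.card_range, nsmul_eq_mul]
      field_simp
    rw [e]
    refine Finset.sum_le_sum fun i hi => ?_
    rw [Finset.mem_range] at hi
    have h0 := hv0 n i hi
    have h1 := hv n i hi
    nlinarith [mul_le_mul_of_nonneg_right (hvD n i hi) (h0.trans h1),
      mul_nonneg (sub_nonneg.2 h1) (sub_nonneg.2 h1)]
  · refine Eventually.of_forall fun n => ?_
    have e : 3 * (n * V (δ / n) ^ 2) = ∑ _i ∈ Finset.range n, 3 * V (δ / n) ^ 2 := by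
      rw [Finset.sum_const, Finset.card_range, nsmul_eq_mul]
      ring
    rw [e]
    refine Finset.sum_le_sum fun i hi => ?_
    rw [Finset.mem_range] at hi
    have h0 := hv0 n i hi
    have h1 := hv n i hi
    gcongr

end Asymptotics

/-- Consistency in probability of the drift estimator `θ̂_{n,x}` built from the temporal
fourth variation of the stochastic heat equation observed at a fixed spatial point
`x ∈ (0,π)` on the uniform time grid of `[c,d]`. -/
theorem stmt13 {Ω : Type*} [MeasurableSpace Ω] (P : Measure Ω) [IsProbabilityMeasure P]
    (θ σ x c d : ℝ) (hθ : 0 < θ) (hσ : 0 < σ) (hx : x ∈ Set.Ioo 0 π)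
    (hc : 0 < c) (hcd : c < d)
    (u : ℝ → Ω → ℝ)
    (hu : IsCenteredGaussianField P u (Set.Icc c d) (heatCovTime θ σ x)) :
    TendstoInMeasure P
      (fun (n : ℕ) ω => 3 * (d - c) * σ ^ 4 /
        (π * ∑ i ∈ Finset.range n,
          (u (c + (d - c) * ((i : ℝ) + 1) / (n : ℝ)) ω
            - u (c + (d - c) * (i : ℝ) / (n : ℝ)) ω) ^ 4))
      atTop (fun _ => θ) := by
  have hδ : 0 < d - c := sub_pos.2 hcd
  have hsin : 0 < Real.sin x := Real.sin_pos_of_pos_of_lt_pi hx.1 hx.2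
  set T : ℕ → ℝ → ℝ := fun n y => c + (d - c) * y / n with hT
  set X : ℕ → ℕ → Ω → ℝ := fun n i ω => u (T n (i + 1)) ω - u (T n i) ω with hX
  set v : ℕ → ℕ → ℝ := fun n i => ∫ ω, X n i ω ^ 2 ∂P with hv
  have hC : ∀ s ∈ Set.Icc c d, ∀ t ∈ Set.Icc c d, 0 ≤ heatCovTime θ σ x s t := fun s hs t ht =>
    heatCovTime_nonneg hθ (hc.le.trans hs.1) (hc.le.trans ht.1)
  have hsymm : ∀ s t, heatCovTime θ σ x s t = heatCovTime θ σ x t s := fun s t =>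
    heatCovTime_comm
  have hT_mono : ∀ n, Monotone (T n) := fun n a b hab => by
    simp only [hT]
    gcongr
  have hT_mem : ∀ (n : ℕ) (y : ℝ), 0 ≤ y → y ≤ n → T n y ∈ Set.Icc c d := fun n y h0 h1 => by
    constructor
    · simp only [hT, le_add_iff_nonneg_right]
      positivity
    · have : (d - c) * y / n ≤ d - c := div_le_of_le_mul₀ (by positivity) hδ.le (by gcongr)
      simp only [hT]
      linarith
  have hmem : ∀ n i : ℕ, i < n → T n i ∈ Set.Icc c d := fun n i hi =>
    hT_mem n i (by positivity) (by exact_mod_cast hi.le)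
  have hmem' : ∀ n i : ℕ, i < n → T n (i + 1) ∈ Set.Icc c d := fun n i hi =>
    hT_mem n _ (by positivity) (by exact_mod_cast hi)
  have hpair : ∀ n i : ℕ, i < n → ∀ j < n, IsCenteredGaussianPair P (X n i) (X n j) :=
    fun n i hi j hj =>
      hu.isCenteredGaussianPair_sub (hmem' n i hi) (hmem n i hi) (hmem' n j hj) (hmem n j hj)
  have hcov : ∀ n i : ℕ, i < n → ∀ j < n, ∫ ω, X n i ω * X n j ω ∂P
      = heatCovTime θ σ x (T n (i + 1)) (T n (j + 1)) - heatCovTime θ σ x (T n (i + 1)) (T n j)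
        - heatCovTime θ σ x (T n i) (T n (j + 1)) + heatCovTime θ σ x (T n i) (T n j) :=
    fun n i hi j hj =>
      hu.integral_sub_mul_sub hC hsymm (hmem' n i hi) (hmem n i hi) (hmem' n j hj) (hmem n j hj)
  have hneg_lt : ∀ n i : ℕ, i < n → ∀ j < n, i < j → ∫ ω, X n i ω * X n j ω ∂P ≤ 0 := by
    intro n i hi j hj hij
    have h := heatCovTime_increments_nonpos (σ := σ) (x := x) hθ (hc.le.trans (hmem n i hi).1)
      (hT_mono n (by linarith : (i : ℝ) ≤ i + 1))
      (hT_mono n (by exact_mod_cast hij : (i : ℝ) + 1 ≤ j))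
      (hT_mono n (by linarith : (j : ℝ) ≤ j + 1))
    rw [hcov n i hi j hj]
    linarith
  have hneg : ∀ n i : ℕ, i < n → ∀ j < n, i ≠ j → ∫ ω, X n i ω * X n j ω ∂P ≤ 0 := by
    intro n i hi j hj hij
    rcases hij.lt_or_gt with h | h
    · exact hneg_lt n i hi j hj h
    · simpa only [mul_comm] using hneg_lt n j hj i hi h
  have hvar : ∀ n i : ℕ, i < n → v n i = heatCovTime θ σ x (T n (i + 1)) (T n (i + 1))
      - 2 * heatCovTime θ σ x (T n i) (T n (i + 1)) + heatCovTime θ σ x (T n i) (T n i) := by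
    intro n i hi
    have h := hcov n i hi i hi
    rw [hsymm (T n (i + 1)) (T n i)] at h
    simp only [hv, sq]
    linarith
  have hstep : ∀ n i : ℕ, i < n → T n i < T n (i + 1) ∧ T n (i + 1) - T n i = (d - c) / n := by
    intro n i hi
    have hn : (0 : ℝ) < n := by exact_mod_cast (Nat.zero_le i).trans_lt hi
    have e : T n (i + 1) - T n i = (d - c) / n := by
      simp only [hT]
      ring
    exact ⟨sub_pos.1 (e ▸ by positivity), e⟩
  have hvV : ∀ n i : ℕ, i < n → v n i ≤ stationaryIncrementVar θ σ x ((d - c) / n) := by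
    intro n i hi
    rw [hvar n i hi, ← (hstep n i hi).2]
    exact heatCovTime_increment_le hθ (hc.le.trans (hmem n i hi).1) (hstep n i hi).1
  have hvD : ∀ n i : ℕ, i < n → stationaryIncrementVar θ σ x ((d - c) / n) - v n i
      ≤ (σ ^ 2 / (θ * π)) * ((∑' k : ℕ, 1 / ((k : ℝ) + 1) ^ 2) / (2 * c)) * ((d - c) / n) := by
    intro n i hi
    rw [hvar n i hi, ← (hstep n i hi).2]
    exact stationaryIncrementVar_sub_le hθ hc (hmem n i hi).1 (hstep n i hi).1
  have hasymp := fun h hh => abs_stationaryIncrementVar_sub_le (σ := σ) (h := h) hθ hh hsin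
  have hmom := fun n => integral_sum_pow_four_sub_sq_le (hpair n) (hvV n) (hneg n)
  have hmean := tendsto_sum_three_mul_sq hδ hasymp
    (fun n i _ => integral_nonneg fun ω => sq_nonneg (X n i ω)) hvV hvD
  have hsq : Tendsto (fun n => ∫ ω, (∑ i ∈ Finset.range n, X n i ω ^ 4
      - ∑ i ∈ Finset.range n, 3 * v n i ^ 2) ^ 2 ∂P) atTop (nhds 0) := by
    refine squeeze_zero (fun n => integral_nonneg fun ω => sq_nonneg _) (fun n => (hmom n).2) ?_
    simpa [mul_assoc] using (tendsto_natCast_mul_pow_four_step hδ hasymp).const_mul 192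
  have hquart := tendstoInMeasure_const_of_tendsto_integral_sq
    (Eventually.of_forall fun n => (hmom n).1) hsq hmean
  have hlim : 3 * ((d - c) * (σ ^ 2 / (θ * π) * √(π * θ)) ^ 2)
      = 3 * (d - c) * σ ^ 4 / (π * θ) := by
    rw [mul_pow, Real.sq_sqrt (by positivity)]
    field_simp
  rw [hlim] at hquart
  have hg : ContinuousAt (fun y => 3 * (d - c) * σ ^ 4 / (π * y))
      (3 * (d - c) * σ ^ 4 / (π * θ)) :=
    continuousAt_const.div (continuousAt_const.mul continuousAt_id) (by positivity)
  have hfin := TendstoInMeasure.comp_continuousAt_const hquart hg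
  have hval : 3 * (d - c) * σ ^ 4 / (π * (3 * (d - c) * σ ^ 4 / (π * θ))) = θ := by
    field_simp
  rw [hval] at hfin
  exact hfin
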